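/- Let (Ω, F, m) be a measure space and (Q_n)_{n≥0} a decreasing sequence of sub-σ-algebras of F such that for all n the restriction of m to Q_n is σ-finite. Then for any f ∈ L¹(Ω, F, m) there exists ψ ∈ L¹(Ω, F, m) such that the conditional expectations E_m(f | Q_n) converge m-almost everywhere to ψ as n → ∞. -/

import Mathlib

open MeasureTheory Filter

open scoped ENNReal NNReal

/-- **Chebyshev's inequality for conditional expectations**, on a set measurable for the
conditioning σ-algebra. -/
lemma rpow_mul_measure_le_setLIntegral_of_le_condExp {Ω : Type*} {Q F : MeasurableSpace Ω}
    {m : Measure Ω} (hQF : Q ≤ F) {p : ℝ≥0} (hp : 1 ≤ p) {f : Ω → ℝ} (hf : Integrable f m)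
    {c : ℝ≥0∞} {s : Set Ω} (hs : MeasurableSet[Q] s) (hc : ∀ x ∈ s, c ≤ ‖(m[f|Q]) x‖ₑ) :
    c ^ (p : ℝ) * m s ≤ ∫⁻ x in s, ‖f x‖ₑ ^ (p : ℝ) ∂m := by
  have hp0 : p ≠ 0 := (zero_lt_one.trans_le hp).ne'
  have hsF : MeasurableSet s := hQF s hs
  calc c ^ (p : ℝ) * m s = ∫⁻ _ in s, c ^ (p : ℝ) ∂m := by simp
    _ ≤ ∫⁻ x in s, ‖(m[f|Q]) x‖ₑ ^ (p : ℝ) ∂m :=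
        setLIntegral_mono' hsF fun x hx => ENNReal.rpow_le_rpow (hc x hx) p.2
    _ = eLpNorm (m[s.indicator f|Q]) p m ^ (p : ℝ) := by
        rw [eLpNorm_congr_ae (condExp_indicator hf hs),
          eLpNorm_indicator_eq_eLpNorm_restrict hsF, eLpNorm_nnreal_pow_eq_lintegral hp0]
    _ ≤ eLpNorm (s.indicator f) p m ^ (p : ℝ) :=
        ENNReal.rpow_le_rpow (eLpNorm_condExp_le_eLpNorm _ (by exact_mod_cast hp)) p.2
    _ = ∫⁻ x in s, ‖f x‖ₑ ^ (p : ℝ) ∂m := by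
        rw [eLpNorm_indicator_eq_eLpNorm_restrict hsF, eLpNorm_nnreal_pow_eq_lintegral hp0]

lemma rpow_mul_measure_exists_le_inter_le_setLIntegral {Ω : Type*} {F : MeasurableSpace Ω}
    {m : Measure Ω} {Q : ℕ → MeasurableSpace Ω} (hQF : ∀ n, Q n ≤ F) (hmono : Antitone Q)
    {p : ℝ≥0} (hp : 1 ≤ p) {f : Ω → ℝ} (hf : Integrable f m) (c : ℝ≥0∞) (n : ℕ) {s : Set Ω}
    (hs : MeasurableSet[Q n] s) :
    c ^ (p : ℝ) * m ({x | ∃ k ≤ n, c ≤ ‖(m[f|Q k]) x‖ₑ} ∩ s) ≤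
      ∫⁻ x in {x | ∃ k ≤ n, c ≤ ‖(m[f|Q k]) x‖ₑ} ∩ s, ‖f x‖ₑ ^ (p : ℝ) ∂m := by
  have hA (k : ℕ) : MeasurableSet[Q k] {x | c ≤ ‖(m[f|Q k]) x‖ₑ} :=
    stronglyMeasurable_condExp.enorm measurableSet_Ici
  induction n generalizing s with
  | zero =>
    refine rpow_mul_measure_le_setLIntegral_of_le_condExp (hQF 0) hp hf ?_ ?_
    · simpa using (hA 0).inter hs
    · simp +contextual
  | succ n ih =>
    set A := {x | c ≤ ‖(m[f|Q (n + 1)]) x‖ₑ} with hAdef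
    set E := {x | ∃ k ≤ n, c ≤ ‖(m[f|Q k]) x‖ₑ} with hE
    have hEmeas : MeasurableSet E := by
      have : E = ⋃ k ∈ Set.Iic n, {x | c ≤ ‖(m[f|Q k]) x‖ₑ} := by ext x; simp [hE]
      rw [this]
      exact .biUnion (Set.to_countable _) fun k _ => hQF k _ (hA k)
    have hsA : MeasurableSet[Q (n + 1)] (s \ A) := hs.diff (hA (n + 1))
    have hunion : {x | ∃ k ≤ n + 1, c ≤ ‖(m[f|Q k]) x‖ₑ} ∩ s = (A ∩ s) ∪ (E ∩ (s \ A)) := by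
      ext x
      simp only [Set.mem_inter_iff, Set.mem_ofPred_eq, Set.mem_union, Set.mem_sdiff, hAdef, hE,
        Nat.le_add_one_iff, or_and_right, exists_or, exists_eq_left]
      by_cases hx : c ≤ ‖(m[f|Q (n + 1)]) x‖ₑ
      · simp +contextual [hx]
      · simp [hx]
    have hdisj : Disjoint (A ∩ s) (E ∩ (s \ A)) :=
      Set.disjoint_left.2 fun x hx hx' => hx'.2.2 hx.1
    have hmeas : MeasurableSet (E ∩ (s \ A)) := hEmeas.inter (hQF _ _ hsA)
    rw [hunion, measure_union hdisj hmeas, lintegral_union hmeas hdisj, mul_add]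
    exact add_le_add
      (rpow_mul_measure_le_setLIntegral_of_le_condExp (hQF _) hp hf ((hA _).inter hs)
        fun x hx => hx.1)
      (ih (hmono n.le_succ _ hsA))

/-- **Doob's maximal inequality** for finitely many conditional expectations along a decreasing
sequence of σ-algebras. -/
lemma rpow_mul_measure_exists_le_condExp_le {Ω : Type*} {F : MeasurableSpace Ω}
    {m : Measure Ω} {Q : ℕ → MeasurableSpace Ω} (hQF : ∀ n, Q n ≤ F) (hmono : Antitone Q)
    {p : ℝ≥0} (hp : 1 ≤ p) {f : Ω → ℝ} (hf : Integrable f m) (c : ℝ≥0∞) (n : ℕ) :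
    c ^ (p : ℝ) * m {x | ∃ k ≤ n, c ≤ ‖(m[f|Q k]) x‖ₑ} ≤ ∫⁻ x, ‖f x‖ₑ ^ (p : ℝ) ∂m := by
  have h := rpow_mul_measure_exists_le_inter_le_setLIntegral hQF hmono hp hf c n
    (@MeasurableSet.univ _ (Q n))
  rw [Set.inter_univ] at h
  exact h.trans (setLIntegral_le_lintegral _ _)

/-- Continuity from below for an existential statement over `ℕ`. -/
lemma measure_exists_le_of_forall_measure_exists_le {Ω : Type*} {F : MeasurableSpace Ω}
    {m : Measure Ω} {P : ℕ → Ω → Prop} {b : ℝ≥0∞} (h : ∀ n, m {x | ∃ k ≤ n, P k x} ≤ b) :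
    m {x | ∃ k, P k x} ≤ b := by
  have hm : Monotone fun n => {x | ∃ k ≤ n, P k x} :=
    fun i j hij x ⟨k, hk, hx⟩ => ⟨k, hk.trans hij, hx⟩
  have hU : {x | ∃ k, P k x} = ⋃ n, {x | ∃ k ≤ n, P k x} := by
    ext x
    simp only [Set.mem_ofPred_eq, Set.mem_iUnion]
    exact ⟨fun ⟨k, hk⟩ => ⟨k, k, le_rfl, hk⟩, fun ⟨_, k, _, hk⟩ => ⟨k, hk⟩⟩
  rw [hU, hm.measure_iUnion]
  exact iSup_le h

lemma ae_cauchySeq_of_forall_measure_eq_zero {Ω : Type*} {F : MeasurableSpace Ω}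
    {m : Measure Ω} {g : ℕ → Ω → ℝ}
    (h : ∀ ε > 0, m {x | ∀ N, ∃ n ≥ N, ε ≤ dist (g n x) (g N x)} = 0) :
    ∀ᵐ x ∂m, CauchySeq fun n => g n x := by
  have hall : ∀ᵐ x ∂m, ∀ j : ℕ, ¬ ∀ N, ∃ n ≥ N, 1 / ((j : ℝ) + 1) ≤ dist (g n x) (g N x) := by
    refine ae_all_iff.2 fun j => ?_
    rw [ae_iff]
    simpa only [not_not] using h (1 / ((j : ℝ) + 1)) (by positivity)
  filter_upwards [hall] with x hx
  refine Metric.cauchySeq_iff'.2 fun ε hε => ?_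
  obtain ⟨j, hj⟩ := exists_nat_one_div_lt hε
  have hxj := hx j
  push Not at hxj
  obtain ⟨N, hN⟩ := hxj
  exact ⟨N, fun n hn => (hN n hn).trans hj⟩

/-- Pythagoras' identity for nested conditional expectations. -/
lemma integral_sq_condExp_sub_condExp {Ω : Type*} {Q R F : MeasurableSpace Ω} {m : Measure Ω}
    (hQF : Q ≤ F) (hRQ : R ≤ Q) [SigmaFinite (m.trim hQF)] [SigmaFinite (m.trim (hRQ.trans hQF))]
    {f : Ω → ℝ} (hf2 : MemLp f 2 m) :
    ∫ x, ((m[f|Q]) x - (m[f|R]) x) ^ 2 ∂m =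
      ∫ x, (m[f|Q]) x ^ 2 ∂m - ∫ x, (m[f|R]) x ^ 2 ∂m := by
  have hQ : MemLp (m[f|Q]) 2 m := hf2.condExp one_le_two
  have hR : MemLp (m[f|R]) 2 m := hf2.condExp one_le_two
  have hQR : Integrable (m[f|Q] * m[f|R]) m := hQ.integrable_mul hR
  have hcross : ∫ x, (m[f|Q]) x * (m[f|R]) x ∂m = ∫ x, (m[f|R]) x ^ 2 ∂m := by
    calc ∫ x, (m[f|Q]) x * (m[f|R]) x ∂m = ∫ x, (m[m[f|Q] * m[f|R]|R]) x ∂m :=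
          (integral_condExp (hRQ.trans hQF)).symm
      _ = ∫ x, (m[f|R]) x ^ 2 ∂m := by
          refine integral_congr_ae ?_
          filter_upwards [condExp_mul_of_stronglyMeasurable_right stronglyMeasurable_condExp hQR
            integrable_condExp, condExp_condExp_of_le (f := f) (μ := m) hRQ hQF] with x h1 h2
          rw [h1, Pi.mul_apply, h2, sq]
  have hexp (x : Ω) : ((m[f|Q]) x - (m[f|R]) x) ^ 2 =
      (m[f|Q]) x ^ 2 - 2 * ((m[f|Q]) x * (m[f|R]) x) + (m[f|R]) x ^ 2 := by ring
  have hQR' : Integrable (fun x => 2 * ((m[f|Q]) x * (m[f|R]) x)) m := hQR.const_mul 2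
  have hsub : Integrable (fun x => (m[f|Q]) x ^ 2 - 2 * ((m[f|Q]) x * (m[f|R]) x)) m :=
    hQ.integrable_sq.sub hQR'
  simp_rw [hexp]
  rw [integral_add hsub hR.integrable_sq,
    integral_sub hQ.integrable_sq hQR', integral_const_mul, hcross]
  ring

/-- The oscillation of the conditional expectations of `f` on an interval `[N, M]` of indices is
controlled by the decrease of their `L²` norms. -/
lemma measure_exists_le_dist_condExp_le {Ω : Type*} {F : MeasurableSpace Ω} {m : Measure Ω}
    {Q : ℕ → MeasurableSpace Ω} (hQF : ∀ n, Q n ≤ F) (hmono : Antitone Q)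
    (hσ : ∀ n, SigmaFinite (m.trim (hQF n))) {f : Ω → ℝ} (hf2 : MemLp f 2 m)
    {ε : ℝ} (hε : 0 < ε) (N j : ℕ) :
    m {x | ∃ k ≤ j, ε ≤ dist ((m[f|Q (N + k)]) x) ((m[f|Q N]) x)} ≤
      ENNReal.ofReal ((∫ x, (m[f|Q N]) x ^ 2 ∂m - ∫ x, (m[f|Q (N + j)]) x ^ 2 ∂m) /
        (ε / 2) ^ 2) := by
  set M := N + j
  set r : Ω → ℝ := m[f|Q N] - m[f|Q M] with hr
  have hrint : Integrable r m := integrable_condExp.sub integrable_condExp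
  have hr2 : MemLp r 2 m := (hf2.condExp one_le_two).sub (hf2.condExp one_le_two)
  have hcond : ∀ᵐ x ∂m, ∀ k, k ≤ j →
      (m[r|Q (N + k)]) x = (m[f|Q (N + k)]) x - (m[f|Q M]) x := by
    refine ae_all_iff.2 fun k => ?_
    by_cases hk : k ≤ j
    · have hstr : m[m[f|Q M]|Q (N + k)] = m[f|Q M] :=
        condExp_of_stronglyMeasurable (hQF _)
          (stronglyMeasurable_condExp.mono (hmono (by omega))) integrable_condExp
      filter_upwards [condExp_sub (μ := m) (f := m[f|Q N]) (g := m[f|Q M]) integrable_condExp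
          integrable_condExp (Q (N + k)),
        condExp_condExp_of_le (f := f) (μ := m) (hmono (Nat.le_add_right N k)) (hQF N)]
        with x h1 h2 _
      rw [hr, h1, Pi.sub_apply, h2, hstr]
    · exact Eventually.of_forall fun x h => absurd h hk
  have hsub : m {x | ∃ k ≤ j, ε ≤ dist ((m[f|Q (N + k)]) x) ((m[f|Q N]) x)} ≤
      m {x | ∃ k ≤ j, ENNReal.ofReal (ε / 2) ≤ ‖(m[r|Q (N + k)]) x‖ₑ} := by
    refine measure_mono_ae ?_
    filter_upwards [hcond] with x hx
    rintro ⟨k, hk, hd⟩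
    have htri := dist_triangle_right ((m[f|Q (N + k)]) x) ((m[f|Q N]) x) ((m[f|Q M]) x)
    rw [Real.dist_eq _ ((m[f|Q M]) x), Real.dist_eq _ ((m[f|Q M]) x), ← hx k hk,
      ← Nat.add_zero N, ← hx 0 j.zero_le] at htri
    have key (i : ℕ) (hi : ε / 2 ≤ |(m[r|Q (N + i)]) x|) :
        ENNReal.ofReal (ε / 2) ≤ ‖(m[r|Q (N + i)]) x‖ₑ := by
      rw [Real.enorm_eq_ofReal_abs]
      exact ENNReal.ofReal_le_ofReal hi
    rcases le_or_gt (ε / 2) |(m[r|Q (N + k)]) x| with h | h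
    · exact ⟨k, hk, key k h⟩
    · refine ⟨0, j.zero_le, key 0 ?_⟩
      simp only [Nat.add_zero] at htri hd ⊢
      linarith
  refine hsub.trans ?_
  have hmax := rpow_mul_measure_exists_le_condExp_le (Q := fun k => Q (N + k))
    (fun k => hQF _) (fun a b hab => hmono (Nat.add_le_add_left hab N)) (p := 2) one_le_two
    hrint (ENNReal.ofReal (ε / 2)) j
  have hlint : ∫⁻ x, ‖r x‖ₑ ^ ((2 : ℝ≥0) : ℝ) ∂m =
      ENNReal.ofReal (∫ x, (m[f|Q N]) x ^ 2 ∂m - ∫ x, (m[f|Q M]) x ^ 2 ∂m) := by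
    rw [← integral_sq_condExp_sub_condExp (hQF N) (hmono (Nat.le_add_right N j)) hf2]
    change _ = ENNReal.ofReal (∫ x, r x ^ 2 ∂m)
    rw [ofReal_integral_eq_lintegral_ofReal hr2.integrable_sq
        (Eventually.of_forall fun x => sq_nonneg _)]
    refine lintegral_congr fun x => ?_
    rw [Real.enorm_eq_ofReal_abs, NNReal.coe_ofNat, ENNReal.rpow_ofNat,
      ← ENNReal.ofReal_pow (abs_nonneg _), sq_abs]
  rw [hlint, NNReal.coe_ofNat, ENNReal.rpow_ofNat, ← ENNReal.ofReal_pow (by positivity),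
    mul_comm] at hmax
  rw [ENNReal.ofReal_div_of_pos (y := (ε / 2) ^ 2) (by positivity)]
  exact (ENNReal.le_div_iff_mul_le (.inl (by simpa using hε.ne')) (.inl ENNReal.ofReal_ne_top)).2 hmax

lemma ae_cauchySeq_condExp_of_memLp_two {Ω : Type*} {F : MeasurableSpace Ω} {m : Measure Ω}
    {Q : ℕ → MeasurableSpace Ω} (hQF : ∀ n, Q n ≤ F) (hmono : Antitone Q)
    (hσ : ∀ n, SigmaFinite (m.trim (hQF n))) {f : Ω → ℝ} (hf2 : MemLp f 2 m) :
    ∀ᵐ x ∂m, CauchySeq fun n => (m[f|Q n]) x := by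
  refine ae_cauchySeq_of_forall_measure_eq_zero fun ε hε => ?_
  set a : ℕ → ℝ := fun n => ∫ x, (m[f|Q n]) x ^ 2 ∂m with ha
  have hanti : Antitone a := by
    intro i j hij
    have h := integral_sq_condExp_sub_condExp (hQF i) (hmono hij) hf2
    have h0 : 0 ≤ ∫ x, ((m[f|Q i]) x - (m[f|Q j]) x) ^ 2 ∂m :=
      integral_nonneg fun x => sq_nonneg _
    simp only [ha]
    linarith
  have hbdd : BddBelow (Set.range a) :=
    ⟨0, by rintro _ ⟨n, rfl⟩; exact integral_nonneg fun x => sq_nonneg _⟩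
  have hbound (N : ℕ) : m {x | ∀ N, ∃ n ≥ N, ε ≤ dist ((m[f|Q n]) x) ((m[f|Q N]) x)} ≤
      ENNReal.ofReal ((a N - ⨅ n, a n) / (ε / 2) ^ 2) := by
    refine le_trans (measure_mono ?_) (measure_exists_le_of_forall_measure_exists_le
      (P := fun k x => ε ≤ dist ((m[f|Q (N + k)]) x) ((m[f|Q N]) x)) fun j =>
      (measure_exists_le_dist_condExp_le hQF hmono hσ hf2 hε N j).trans ?_)
    · intro x hx
      obtain ⟨n, hn, hd⟩ := hx N
      exact ⟨n - N, by rwa [Nat.add_sub_cancel' hn]⟩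
    · gcongr
      exact ciInf_le hbdd (N + j)
  have hlim : Tendsto (fun N => ENNReal.ofReal ((a N - ⨅ n, a n) / (ε / 2) ^ 2)) atTop
      (nhds 0) := by
    have h := ENNReal.tendsto_ofReal
      (((tendsto_atTop_ciInf hanti hbdd).sub_const (⨅ n, a n)).div_const ((ε / 2) ^ 2))
    simpa using h
  exact le_antisymm (ge_of_tendsto' hlim hbound) zero_le

lemma ae_cauchySeq_condExp {Ω : Type*} {F : MeasurableSpace Ω} {m : Measure Ω}
    {Q : ℕ → MeasurableSpace Ω} (hQF : ∀ n, Q n ≤ F) (hmono : Antitone Q)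
    (hσ : ∀ n, SigmaFinite (m.trim (hQF n))) {f : Ω → ℝ} (hf : Integrable f m) :
    ∀ᵐ x ∂m, CauchySeq fun n => (m[f|Q n]) x := by
  refine ae_cauchySeq_of_forall_measure_eq_zero fun ε hε => ?_
  set c := ENNReal.ofReal (ε / 4) with hc
  have hc0 : c ≠ 0 := by simpa [hc] using hε
  have hctop : c ≠ ∞ := ENNReal.ofReal_ne_top
  suffices hmul : c * m {x | ∀ N, ∃ n ≥ N, ε ≤ dist ((m[f|Q n]) x) ((m[f|Q N]) x)} = 0 from
    (mul_eq_zero.1 hmul).resolve_left hc0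
  refine le_antisymm (le_of_forall_pos_le_add fun δ hδ => ?_) zero_le
  rw [zero_add]
  obtain ⟨h, hfh, hhint, hh2⟩ :
      ∃ h : Ω → ℝ, eLpNorm (f - h) 1 m < δ ∧ Integrable h m ∧ MemLp h 2 m := by
    obtain ⟨h, hfh, hh⟩ := (memLp_one_iff_integrable.2 hf).exists_simpleFunc_eLpNorm_sub_lt
      ENNReal.one_ne_top hδ.ne'
    have hhint := memLp_one_iff_integrable.1 hh
    exact ⟨h, hfh, hhint,
      (SimpleFunc.memLp_iff_integrable two_ne_zero ENNReal.ofNat_ne_top).2 hhint⟩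
  have hrint : Integrable (f - h) m := hf.sub hhint
  have hdecomp : ∀ᵐ x ∂m, ∀ n, (m[f - h|Q n]) x = (m[f|Q n]) x - (m[h|Q n]) x :=
    ae_all_iff.2 fun n => condExp_sub hf hhint (Q n)
  have hsub : m {x | ∀ N, ∃ n ≥ N, ε ≤ dist ((m[f|Q n]) x) ((m[f|Q N]) x)} ≤
      m {x | ∃ n, c ≤ ‖(m[f - h|Q n]) x‖ₑ} := by
    refine measure_mono_ae ?_
    filter_upwards [hdecomp, ae_cauchySeq_condExp_of_memLp_two hQF hmono hσ hh2] with x hx hcau hosc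
    obtain ⟨N, hN⟩ := Metric.cauchySeq_iff'.1 hcau (ε / 2) (half_pos hε)
    obtain ⟨n, hn, hd⟩ := hosc N
    have hNn := hN n hn
    rw [Real.dist_eq] at hd hNn
    have key (i : ℕ) (hi : ε / 4 ≤ |(m[f - h|Q i]) x|) : c ≤ ‖(m[f - h|Q i]) x‖ₑ := by
      rw [Real.enorm_eq_ofReal_abs]
      exact ENNReal.ofReal_le_ofReal hi
    rcases le_or_gt (ε / 4) |(m[f - h|Q n]) x| with h1 | h1
    · exact ⟨n, key n h1⟩
    · refine ⟨N, key N ?_⟩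
      by_contra! h2
      rw [hx n] at h1
      rw [hx N] at h2
      rw [abs_lt] at h1 h2 hNn
      rcases le_abs.1 hd with h3 | h3 <;> linarith [h1.1, h1.2, h2.1, h2.2, hNn.1, hNn.2]
  have hmax : m {x | ∃ n, c ≤ ‖(m[f - h|Q n]) x‖ₑ} ≤ eLpNorm (f - h) 1 m / c := by
    refine measure_exists_le_of_forall_measure_exists_le fun n => ?_
    rw [ENNReal.le_div_iff_mul_le (.inl hc0) (.inl hctop), mul_comm, eLpNorm_one_eq_lintegral_enorm]
    simpa using rpow_mul_measure_exists_le_condExp_le hQF hmono le_rfl hrint c n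
  calc c * m {x | ∀ N, ∃ n ≥ N, ε ≤ dist ((m[f|Q n]) x) ((m[f|Q N]) x)}
      ≤ c * (eLpNorm (f - h) 1 m / c) := mul_le_mul_right (hsub.trans hmax) c
    _ ≤ eLpNorm (f - h) 1 m := ENNReal.mul_div_le
    _ ≤ δ := hfh.le

/-- Convergence of backwards martingales on a possibly infinite measure space:
if `(Q n)` is a decreasing sequence of sub-σ-algebras of `F` such that `m` is
σ-finite on each `Q n`, then for every `f ∈ L¹(m)` the conditional expectations
`m[f | Q n]` converge `m`-almost everywhere to some integrable function `ψ`. -/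
theorem backwards_martingale_convergence
    {Ω : Type*} {F : MeasurableSpace Ω} (m : Measure Ω)
    (Q : ℕ → MeasurableSpace Ω) (hQF : ∀ n, Q n ≤ F) (hmono : Antitone Q)
    (hσ : ∀ n, SigmaFinite (m.trim (hQF n)))
    (f : Ω → ℝ) (hf : Integrable f m) :
    ∃ ψ : Ω → ℝ, Integrable ψ m ∧
      ∀ᵐ x ∂m, Tendsto (fun n => (m[f|Q n]) x) atTop (nhds (ψ x)) := by
  have hlim : ∀ᵐ x ∂m, ∃ l, Tendsto (fun n => (m[f|Q n]) x) atTop (nhds l) := by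
    filter_upwards [ae_cauchySeq_condExp hQF hmono hσ hf] with x hx
    exact cauchySeq_tendsto_of_complete hx
  have hmeas (n : ℕ) : AEStronglyMeasurable (m[f|Q n]) m := integrable_condExp.1
  obtain ⟨ψ, hψ, hψlim⟩ := exists_stronglyMeasurable_limit_of_tendsto_ae hmeas hlim
  refine ⟨ψ, memLp_one_iff_integrable.1 ⟨hψ.aestronglyMeasurable, ?_⟩, hψlim⟩
  calc eLpNorm ψ 1 m ≤ liminf (fun n => eLpNorm (m[f|Q n]) 1 m) atTop :=
        Lp.eLpNorm_lim_le_liminf_eLpNorm hmeas ψ hψlim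
    _ ≤ liminf (fun _ : ℕ => eLpNorm f 1 m) atTop :=
        liminf_le_liminf (Eventually.of_forall fun n => eLpNorm_condExp_le_eLpNorm f le_rfl)
    _ = eLpNorm f 1 m := liminf_const _
    _ < ∞ := (memLp_one_iff_integrable.2 hf).2
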